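/- (Energy bound for arbitrary signals.) Let A ∈ ℂ^{m×d} satisfy the restricted isometry property with parameters (s, δ) for some s ≥ 1 and 0 ≤ δ < 1. Then for every x ∈ ℂ^d (not necessarily sparse), ‖Ax‖₂ ≤ √(1 + δ) ( ‖x‖₂ + ‖x‖₁/√s ). -/

import Mathlib

open scoped BigOperators

/-- The Euclidean (ℓ²) norm of a vector. -/
noncomputable def l2 {n : ℕ} (x : Fin n → ℂ) : ℝ := Real.sqrt (∑ i, ‖x i‖ ^ 2)

/-- The ℓ¹ norm of a vector. -/
noncomputable def l1 {n : ℕ} (x : Fin n → ℂ) : ℝ := ∑ i, ‖x i‖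

/-- `x` has at most `s` nonzero entries. -/
def Sparse {n : ℕ} (s : ℕ) (x : Fin n → ℂ) : Prop :=
  ∃ T : Finset (Fin n), T.card ≤ s ∧ ∀ i ∉ T, x i = 0

/-- `A` satisfies the restricted isometry property with parameters `(s, δ)`. -/
def RIP {m d : ℕ} (A : Matrix (Fin m) (Fin d) ℂ) (s : ℕ) (δ : ℝ) : Prop :=
  ∀ x : Fin d → ℂ, Sparse s x →
    (1 - δ) * (l2 x) ^ 2 ≤ (l2 (A.mulVec x)) ^ 2 ∧
      (l2 (A.mulVec x)) ^ 2 ≤ (1 + δ) * (l2 x) ^ 2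

/-- The spectral norm `‖M‖₂` of a matrix. -/
noncomputable def specNorm {m d : ℕ} (M : Matrix (Fin m) (Fin d) ℂ) : ℝ :=
  sSup {r | ∃ x : Fin d → ℂ, l2 x ≤ 1 ∧ r = l2 (M.mulVec x)}

/-- `‖M‖^{(s)}`: the largest spectral norm over all `s`-column submatrices of `M`,
equivalently the sup of `‖Mx‖₂` over `s`-sparse `x` with `‖x‖₂ ≤ 1`. -/
noncomputable def specNormS {m d : ℕ} (s : ℕ) (M : Matrix (Fin m) (Fin d) ℂ) : ℝ :=
  sSup {r | ∃ x : Fin d → ℂ, Sparse s x ∧ l2 x ≤ 1 ∧ r = l2 (M.mulVec x)}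

/-- `xs` is a best `s`-sparse approximation of `x`: it keeps `s` entries of `x` of
largest magnitude (all entries if `x` has fewer than `s` coordinates) and sets the
others to zero. -/
def IsSparseApprox {n : ℕ} (s : ℕ) (x xs : Fin n → ℂ) : Prop :=
  ∃ T : Finset (Fin n), T.card = min s n ∧
    (∀ i, xs i = if i ∈ T then x i else 0) ∧
    ∀ i ∈ T, ∀ j ∉ T, ‖x j‖ ≤ ‖x i‖

theorem l2_eq_norm {n : ℕ} (x : Fin n → ℂ) : l2 x = ‖WithLp.toLp 2 x‖ := by
  simp [l2, EuclideanSpace.norm_eq]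

theorem l2_add_le {n : ℕ} (x y : Fin n → ℂ) : l2 (x + y) ≤ l2 x + l2 y := by
  simp only [l2_eq_norm, WithLp.toLp_add]
  exact norm_add_le _ _

theorem l2_nonneg {n : ℕ} (x : Fin n → ℂ) : 0 ≤ l2 x := Real.sqrt_nonneg _

theorem l1_nonneg {n : ℕ} (x : Fin n → ℂ) : 0 ≤ l1 x :=
  Finset.sum_nonneg fun _ _ => norm_nonneg _

theorem l2_mono {n : ℕ} {x y : Fin n → ℂ} (h : ∀ i, ‖x i‖ ≤ ‖y i‖) : l2 x ≤ l2 y :=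
  Real.sqrt_le_sqrt <| Finset.sum_le_sum fun i _ => pow_le_pow_left₀ (norm_nonneg _) (h i) 2

theorem Sparse.l2_le {n s : ℕ} {x : Fin n → ℂ} (hx : Sparse s x) {M : ℝ} (hM : 0 ≤ M)
    (hxM : ∀ i, ‖x i‖ ≤ M) : l2 x ≤ Real.sqrt s * M := by
  obtain ⟨T, hT, hxT⟩ := hx
  have hsum : ∑ i, ‖x i‖ ^ 2 = ∑ i ∈ T, ‖x i‖ ^ 2 :=
    (Finset.sum_subset T.subset_univ fun i _ hi => by simp [hxT i hi]).symm
  rw [← Real.sqrt_sq hM, ← Real.sqrt_mul (Nat.cast_nonneg s), l2, hsum]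
  refine Real.sqrt_le_sqrt ?_
  calc ∑ i ∈ T, ‖x i‖ ^ 2 ≤ T.card • M ^ 2 :=
        Finset.sum_le_card_nsmul _ _ _ fun i _ => pow_le_pow_left₀ (norm_nonneg _) (hxM i) 2
    _ ≤ s * M ^ 2 := by
        rw [nsmul_eq_mul]
        gcongr

theorem RIP.l2_mulVec_le {m d s : ℕ} {A : Matrix (Fin m) (Fin d) ℂ} {δ : ℝ} (hA : RIP A s δ)
    {x : Fin d → ℂ} (hx : Sparse s x) : l2 (A.mulVec x) ≤ Real.sqrt (1 + δ) * l2 x := by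
  rw [← Real.sqrt_sq (l2_nonneg x), ← Real.sqrt_mul' _ (sq_nonneg _)]
  exact Real.le_sqrt_of_sq_le (hA x hx).2

theorem RIP.l2_mulVec_le_add {m d s : ℕ} {A : Matrix (Fin m) (Fin d) ℂ} {δ : ℝ}
    (hA : RIP A s δ) {x : Fin d → ℂ} (hx : Sparse s x) {N : ℝ} (hN : l2 x ≤ N) :
    l2 (A.mulVec x) ≤ Real.sqrt (1 + δ) * (N + l1 x / Real.sqrt s) :=
  (hA.l2_mulVec_le hx).trans <| mul_le_mul_of_nonneg_left
    (le_add_of_le_of_nonneg hN (div_nonneg (l1_nonneg x) (Real.sqrt_nonneg _)))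
    (Real.sqrt_nonneg _)

/-- Every finite set contains a subset of prescribed size on which `f` is largest. -/
theorem exists_subset_card_eq_of_largest {α : Type*} (f : α → ℝ) (S : Finset α) (k : ℕ)
    (hk : k ≤ S.card) :
    ∃ T ⊆ S, T.card = k ∧ ∀ i ∈ T, ∀ j ∈ S, j ∉ T → f j ≤ f i := by
  classical
  induction k with
  | zero => exact ⟨∅, by simp⟩
  | succ k ih =>
    obtain ⟨T, hTS, hTk, hT⟩ := ih (by omega)
    have hne : (S \ T).Nonempty := by
      rw [← Finset.card_pos, Finset.card_sdiff_of_subset hTS]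
      omega
    obtain ⟨a, ha, hmax⟩ := Finset.exists_max_image (S \ T) f hne
    rw [Finset.mem_sdiff] at ha
    refine ⟨insert a T, Finset.insert_subset ha.1 hTS, ?_, ?_⟩
    · rw [Finset.card_insert_of_notMem ha.2, hTk]
    · intro i hi j hj hjT
      rw [Finset.mem_insert, not_or] at hjT
      rcases Finset.mem_insert.1 hi with rfl | hi
      · exact hmax j (Finset.mem_sdiff.2 ⟨hj, hjT.2⟩)
      · exact hT i hi j hj hjT.2

/-- A vector with more than `s` nonzero entries splits into its `s` largest entries `y` and a
remainder `z` whose entries are at most the average magnitude of the entries of `y`. -/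
theorem Sparse.exists_add_of_not_sparse {n s k : ℕ} (hs : 1 ≤ s) {x : Fin n → ℂ}
    (hx : Sparse (k + 1) x) (hxs : ¬ Sparse s x) :
    ∃ y z : Fin n → ℂ, x = y + z ∧ Sparse s y ∧ Sparse k z ∧ (∀ i, ‖y i‖ ≤ ‖x i‖) ∧
      l1 x = l1 y + l1 z ∧ ∃ μ : ℝ, 0 ≤ μ ∧ s * μ ≤ l1 y ∧ ∀ i, ‖z i‖ ≤ μ := by
  obtain ⟨S, hSk, hS⟩ := hx
  have hsS : s ≤ S.card := by
    by_contra! h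
    exact hxs ⟨S, h.le, hS⟩
  obtain ⟨T, hTS, hTs, hT⟩ := exists_subset_card_eq_of_largest (fun i => ‖x i‖) S s hsS
  obtain ⟨a, ha, hmin⟩ := Finset.exists_min_image T (fun i => ‖x i‖)
    (Finset.card_pos.1 (by omega))
  refine ⟨fun i => if i ∈ T then x i else 0, fun i => if i ∈ T then 0 else x i, ?_,
    ⟨T, hTs.le, fun i hi => if_neg hi⟩, ⟨S \ T, ?_, ?_⟩, ?_, ?_, ‖x a‖, norm_nonneg _, ?_, ?_⟩
  · ext i
    by_cases hi : i ∈ T <;> simp [hi]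
  · rw [Finset.card_sdiff_of_subset hTS]
    omega
  · intro i hi
    by_cases hiT : i ∈ T
    · simp [hiT]
    · simpa [hiT] using hS i fun h => hi (Finset.mem_sdiff.2 ⟨h, hiT⟩)
  · intro i
    by_cases hi : i ∈ T <;> simp [hi]
  · simp only [l1, ← Finset.sum_add_distrib]
    refine Finset.sum_congr rfl fun i _ => ?_
    by_cases hi : i ∈ T <;> simp [hi]
  · have hl1 : l1 (fun i => if i ∈ T then x i else 0) = ∑ i ∈ T, ‖x i‖ := by
      simp [l1, apply_ite norm]
    rw [hl1, ← hTs, ← nsmul_eq_mul]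
    exact Finset.card_nsmul_le_sum _ _ _ hmin
  · intro i
    by_cases hiT : i ∈ T
    · simp [hiT]
    by_cases hiS : i ∈ S
    · simpa [hiT] using hT a ha i hiS hiT
    · simp [hiT, hS i hiS]

theorem sqrt_mul_le_div_sqrt {s μ L : ℝ} (hs : 0 < s) (h : s * μ ≤ L) :
    Real.sqrt s * μ ≤ L / Real.sqrt s := by
  rw [le_div_iff₀ (Real.sqrt_pos.2 hs)]
  rwa [mul_right_comm, Real.mul_self_sqrt hs.le]

/-- Combining the bound for the head `y` with the sup-norm bound for the tail `z`. -/
theorem RIP.l2_mulVec_add_le {m d s : ℕ} (hs : 1 ≤ s) {A : Matrix (Fin m) (Fin d) ℂ} {δ : ℝ}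
    (hA : RIP A s δ) {y z : Fin d → ℂ} (hy : Sparse s y) {μ N : ℝ} (hμ : s * μ ≤ l1 y)
    (hN : l2 y ≤ N)
    (hz : l2 (A.mulVec z) ≤ Real.sqrt (1 + δ) * (Real.sqrt s * μ + l1 z / Real.sqrt s)) :
    l2 (A.mulVec (y + z)) ≤ Real.sqrt (1 + δ) * (N + (l1 y + l1 z) / Real.sqrt s) := by
  have hs' : (0 : ℝ) < s := by exact_mod_cast hs
  rw [Matrix.mulVec_add]
  calc l2 (A.mulVec y + A.mulVec z) ≤ l2 (A.mulVec y) + l2 (A.mulVec z) := l2_add_le _ _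
    _ ≤ Real.sqrt (1 + δ) * l2 y
        + Real.sqrt (1 + δ) * (Real.sqrt s * μ + l1 z / Real.sqrt s) :=
      add_le_add (hA.l2_mulVec_le hy) hz
    _ = Real.sqrt (1 + δ) * (l2 y + (Real.sqrt s * μ + l1 z / Real.sqrt s)) := by ring
    _ ≤ Real.sqrt (1 + δ) * (N + (l1 y + l1 z) / Real.sqrt s) := by
      rw [add_div]
      gcongr
      exact sqrt_mul_le_div_sqrt hs' hμ

theorem RIP.l2_mulVec_le_of_norm_le {m d s : ℕ} (hs : 1 ≤ s) {A : Matrix (Fin m) (Fin d) ℂ}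
    {δ : ℝ} (hA : RIP A s δ) {k : ℕ} {x : Fin d → ℂ} (hx : Sparse k x) {M : ℝ} (hM : 0 ≤ M)
    (hxM : ∀ i, ‖x i‖ ≤ M) :
    l2 (A.mulVec x) ≤ Real.sqrt (1 + δ) * (Real.sqrt s * M + l1 x / Real.sqrt s) := by
  induction k generalizing x M with
  | zero =>
    obtain ⟨T, hT, hxT⟩ := hx
    have hxs : Sparse s x := ⟨T, hT.trans s.zero_le, hxT⟩
    exact hA.l2_mulVec_le_add hxs (hxs.l2_le hM hxM)
  | succ k ih =>
    by_cases hxs : Sparse s x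
    · exact hA.l2_mulVec_le_add hxs (hxs.l2_le hM hxM)
    · obtain ⟨y, z, hxyz, hy, hz, hyx, hl1, μ, hμ, hμy, hzμ⟩ := hx.exists_add_of_not_sparse hs hxs
      rw [hl1, hxyz]
      exact hA.l2_mulVec_add_le hs hy hμy (hy.l2_le hM fun i => (hyx i).trans (hxM i))
        (ih hz hμ hzμ)

/-- Energy bound for arbitrary signals (Prop. 3.5 of CoSaMP). -/
theorem energy_bound (m d s : ℕ) (hs : 1 ≤ s)
    (A : Matrix (Fin m) (Fin d) ℂ)
    (δ : ℝ) (hδ0 : 0 ≤ δ) (hδ1 : δ < 1) (hRIP : RIP A s δ) :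
    ∀ x : Fin d → ℂ,
      l2 (A.mulVec x) ≤ Real.sqrt (1 + δ) * (l2 x + l1 x / Real.sqrt s) := by
  intro x
  by_cases hxs : Sparse s x
  · exact hRIP.l2_mulVec_le_add hxs le_rfl
  · have hx : Sparse (d + 1) x := ⟨Finset.univ, by simp, by simp⟩
    obtain ⟨y, z, hxyz, hy, hz, hyx, hl1, μ, hμ, hμy, hzμ⟩ := hx.exists_add_of_not_sparse hs hxs
    have h := hRIP.l2_mulVec_add_le hs hy hμy (l2_mono hyx)
      (hRIP.l2_mulVec_le_of_norm_le hs hz hμ hzμ)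
    rwa [← hxyz, ← hl1] at h
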